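/- For every integer k ≥ 2, the stabilizer of the configuration 𝒲_k = ⋃_{j=1}^k T_j in the group of ℝ-linear isometries of ℝ⁴ ≅ ℂ² (i.e., the set of A ∈ O(4) with A(𝒲_k) = 𝒲_k) is exactly the subgroup generated by the four families of maps: (z₁,z₂) ↦ (z₁, e^{iπ/k}z₂); (z₁,z₂) ↦ (z̄₁, z̄₂); (z₁,z₂) ↦ (z₂, z₁); and (z₁,z₂) ↦ (e^{iα}z₁, e^{iα}z₂) for all α ∈ ℝ. -/

import Mathlib

open Complex Real

/-- The real inner product on `ℂ × ℂ ≅ ℝ⁴`. -/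
noncomputable def realInner (p q : ℂ × ℂ) : ℝ :=
  (p.1 * (starRingEnd ℂ) q.1 + p.2 * (starRingEnd ℂ) q.2).re

/-- The Clifford torus `T_j = {e^{iz}(cos r, e^{i(j−1)π/k} sin r)}`. -/
noncomputable def torusT (k : ℕ) (j : ℤ) : Set (ℂ × ℂ) :=
  {p | ∃ r z : ℝ,
    p = (Complex.exp (z * Complex.I) * (Real.cos r : ℂ),
         Complex.exp (z * Complex.I) *
           Complex.exp (((((j : ℝ) - 1) * π / k : ℝ) : ℂ) * Complex.I) * (Real.sin r : ℂ))}

/-- The configuration `𝒲_k = ⋃_{j=1}^k T_j`. -/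
noncomputable def bigW (k : ℕ) : Set (ℂ × ℂ) := ⋃ j ∈ Finset.Icc (1 : ℤ) (k : ℤ), torusT k j

/-- The four families of generators: `R_{C₁}^{π/k}`, reflection through `C_{0,0}`,
reflection through `C'₁`, and the simultaneous rotations `R_{C₁}^α R_{C₂}^α`. -/
noncomputable def genSetW (k : ℕ) : Set ((ℂ × ℂ) ≃ₗ[ℝ] (ℂ × ℂ)) :=
  {A | (∀ z : ℂ × ℂ, A z = (z.1, Complex.exp (((π / k : ℝ) : ℂ) * Complex.I) * z.2)) ∨
       (∀ z : ℂ × ℂ, A z = ((starRingEnd ℂ) z.1, (starRingEnd ℂ) z.2)) ∨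
       (∀ z : ℂ × ℂ, A z = (z.2, z.1)) ∨
       (∃ α : ℝ, ∀ z : ℂ × ℂ,
         A z = (Complex.exp ((α : ℂ) * Complex.I) * z.1,
                Complex.exp ((α : ℂ) * Complex.I) * z.2))}

open ComplexConjugate in
/-- The function whose zero set is the cone over `bigW k`. -/
noncomputable def coneForm (k : ℕ) (p : ℂ × ℂ) : ℝ := ((conj p.1 * p.2) ^ k).im

/-- Linear isometries of `ℂ × ℂ ≅ ℝ⁴` preserving the cone over `bigW k`. -/
def PreservesCone (k : ℕ) (A : (ℂ × ℂ) ≃ₗ[ℝ] (ℂ × ℂ)) : Prop :=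
  (∀ v w : ℂ × ℂ, realInner (A v) (A w) = realInner v w) ∧
    ∀ p, coneForm k (A p) = 0 ↔ coneForm k p = 0

lemma norm_eq_one_of_sq {z : ℂ} (h : ‖z‖ ^ 2 = 1) : ‖z‖ = 1 :=
  (pow_eq_one_iff_of_nonneg (norm_nonneg z) two_ne_zero).1 h

lemma realInner_self (p : ℂ × ℂ) : realInner p p = ‖p.1‖ ^ 2 + ‖p.2‖ ^ 2 := by
  simp only [realInner, Complex.mul_conj, Complex.normSq_eq_norm_sq]
  norm_cast

lemma exists_cos_sin_eq {x y : ℝ} (h : x ^ 2 + y ^ 2 = 1) :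
    ∃ r : ℝ, Real.cos r = x ∧ Real.sin r = y := by
  have hn : ‖(⟨x, y⟩ : ℂ)‖ = 1 := by
    have : ‖(⟨x, y⟩ : ℂ)‖ ^ 2 = 1 := by
      rw [← Complex.normSq_eq_norm_sq, Complex.normSq_mk]; linarith
    exact norm_eq_one_of_sq this
  refine ⟨Complex.arg ⟨x, y⟩, ?_, ?_⟩
  · have := Complex.norm_mul_cos_arg ⟨x, y⟩
    simpa [hn] using this
  · have := Complex.norm_mul_sin_arg ⟨x, y⟩
    simpa [hn] using this

lemma exp_int_mul_pi (n : ℤ) :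
    Complex.exp ((n : ℂ) * π * Complex.I) = ((Real.cos (n * π) : ℝ) : ℂ) := by
  have := Complex.exp_ofReal_mul_I_im (n * π)
  apply Complex.ext
  · have h := Complex.exp_ofReal_mul_I_re (n * π)
    push_cast at h
    rw [h, Complex.ofReal_re]
  · push_cast at this
    rw [this, Real.sin_int_mul_pi, Complex.ofReal_im]

lemma exists_eq_exp_mul_real_of_pow_im_eq_zero {k : ℕ} (hk : 1 ≤ k) {w : ℂ}
    (hw : (w ^ k).im = 0) :
    ∃ m : ℤ, 0 ≤ m ∧ m < k ∧ ∃ s : ℝ,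
      w = Complex.exp (((m * π / k : ℝ) : ℂ) * Complex.I) * (s : ℂ) := by
  by_cases h0 : w = 0
  · exact ⟨0, le_rfl, by exact_mod_cast hk, 0, by simp [h0]⟩
  have hk0 : (k : ℝ) ≠ 0 := by positivity
  have hkC : (k : ℂ) ≠ 0 := by exact_mod_cast hk0
  have hpow : w ^ k = ((‖w‖ ^ k : ℝ) : ℂ) * Complex.exp (((k * w.arg : ℝ) : ℂ) * Complex.I) := by
    conv_lhs => rw [← Complex.norm_mul_exp_arg_mul_I w, mul_pow, ← Complex.exp_nat_mul]
    push_cast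
    ring_nf
  rw [hpow, Complex.im_ofReal_mul, Complex.exp_ofReal_mul_I_im] at hw
  have hsin := (mul_eq_zero.1 hw).resolve_left (pow_ne_zero _ (norm_ne_zero_iff.2 h0))
  obtain ⟨n, hn⟩ := Real.sin_eq_zero_iff.1 hsin
  have hkZ : (0 : ℤ) < k := by exact_mod_cast hk
  refine ⟨n % k, Int.emod_nonneg _ hkZ.ne', Int.emod_lt_of_pos _ hkZ,
    Real.cos ((n / k : ℤ) * π) * ‖w‖, ?_⟩
  have hdiv : (n : ℂ) = ((n % k : ℤ) : ℂ) + k * ((n / k : ℤ) : ℂ) := by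
    exact_mod_cast (Int.emod_add_mul_ediv n k).symm
  have harg : (w.arg : ℂ) = n * π / k := by
    rw [eq_div_iff hkC]
    exact_mod_cast (by rw [hn]; ring : w.arg * k = n * π)
  conv_lhs => rw [← Complex.norm_mul_exp_arg_mul_I w]
  rw [Complex.ofReal_mul, ← exp_int_mul_pi, ← mul_assoc, ← Complex.exp_add, mul_comm]
  congr 2
  rw [harg, hdiv]
  push_cast
  field_simp

lemma mem_bigW_iff {k : ℕ} (hk : 1 ≤ k) (p : ℂ × ℂ) :
    p ∈ bigW k ↔ realInner p p = 1 ∧ coneForm k p = 0 := by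
  have hkC : (k : ℂ) ≠ 0 := by exact_mod_cast (by omega : k ≠ 0)
  simp only [bigW, Set.mem_iUnion, Finset.mem_Icc, exists_prop, torusT, Set.mem_ofPred_eq]
  constructor
  · rintro ⟨j, -, r, z, rfl⟩
    constructor
    · rw [realInner_self]
      simp only [norm_mul, Complex.norm_exp_ofReal_mul_I, Complex.norm_real, one_mul,
        Real.norm_eq_abs, sq_abs, Real.cos_sq_add_sin_sq]
    · have hz : (starRingEnd ℂ) (Complex.exp (z * Complex.I)) * Complex.exp (z * Complex.I)
          = 1 := by
        rw [← Complex.normSq_eq_conj_mul_self, Complex.normSq_eq_norm_sq,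
          Complex.norm_exp_ofReal_mul_I]
        simp
      have hθ : Complex.exp (((((j : ℝ) - 1) * π / k : ℝ) : ℂ) * Complex.I) ^ k
          = ((Real.cos ((j - 1 : ℤ) * π) : ℝ) : ℂ) := by
        rw [← exp_int_mul_pi, ← Complex.exp_nat_mul]
        congr 1
        push_cast
        field_simp
      set e := Complex.exp (z * Complex.I)
      set f := Complex.exp (((((j : ℝ) - 1) * π / k : ℝ) : ℂ) * Complex.I)
      have : (starRingEnd ℂ) (e * (Real.cos r : ℂ)) * (e * f * (Real.sin r : ℂ))
          = f * ((Real.cos r * Real.sin r : ℝ) : ℂ) := by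
        rw [map_mul, Complex.conj_ofReal, Complex.ofReal_mul]
        linear_combination (Real.cos r : ℂ) * Real.sin r * f * hz
      simp only [coneForm]
      rw [this, mul_pow, hθ, ← Complex.ofReal_pow, ← Complex.ofReal_mul, Complex.ofReal_im]
  · rintro ⟨hn, hc⟩
    rw [realInner_self] at hn
    by_cases h0 : p.1 = 0
    · have h2 : ‖p.2‖ = 1 := norm_eq_one_of_sq (by simpa [h0] using hn)
      refine ⟨1, ⟨le_rfl, by exact_mod_cast hk⟩, π / 2, p.2.arg, Prod.ext ?_ ?_⟩
      · simp [h0]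
      · have := Complex.norm_mul_exp_arg_mul_I p.2
        rw [h2] at this
        simpa using this.symm
    · set e := Complex.exp (p.1.arg * Complex.I) with he
      have he1 : (starRingEnd ℂ) e * e = 1 := by
        rw [← Complex.normSq_eq_conj_mul_self, Complex.normSq_eq_norm_sq, he,
          Complex.norm_exp_ofReal_mul_I]
        simp
      have hp1 : p.1 = e * (‖p.1‖ : ℂ) := by
        rw [mul_comm]; exact (Complex.norm_mul_exp_arg_mul_I p.1).symm
      have hprod : (starRingEnd ℂ) p.1 * p.2 = (‖p.1‖ : ℂ) * ((starRingEnd ℂ) e * p.2) := by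
        conv_lhs => rw [hp1]
        rw [map_mul, Complex.conj_ofReal]
        ring
      rw [coneForm, hprod, mul_pow, ← Complex.ofReal_pow, Complex.im_ofReal_mul] at hc
      obtain ⟨m, hm0, hmk, s, hs⟩ := exists_eq_exp_mul_real_of_pow_im_eq_zero hk
        ((mul_eq_zero.1 hc).resolve_left (pow_ne_zero _ (norm_ne_zero_iff.2 h0)))
      have hns : ‖p.2‖ ^ 2 = s ^ 2 := by
        have := congrArg norm hs
        rw [norm_mul, norm_mul, Complex.norm_conj, he, Complex.norm_exp_ofReal_mul_I,
          Complex.norm_exp_ofReal_mul_I, one_mul, one_mul, Complex.norm_real] at this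
        rw [this, Real.norm_eq_abs, sq_abs]
      rw [hns] at hn
      obtain ⟨r, hr1, hr2⟩ := exists_cos_sin_eq hn
      refine ⟨m + 1, ⟨by omega, by omega⟩, r, p.1.arg, Prod.ext ?_ ?_⟩
      · rw [hr1]; exact hp1
      · simp only [hr2]
        rw [mul_assoc, show ((m + 1 : ℤ) : ℝ) - 1 = m by push_cast; ring, ← hs]
        linear_combination -p.2 * he1

lemma coneForm_real_smul (k : ℕ) (s : ℝ) (p : ℂ × ℂ) :
    coneForm k (s • p) = (s ^ 2) ^ k * coneForm k p := by
  have : ((starRingEnd ℂ) (s • p).1 * (s • p).2) ^ k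
      = (((s ^ 2) ^ k : ℝ) : ℂ) * ((starRingEnd ℂ) p.1 * p.2) ^ k := by
    rw [Complex.ofReal_pow, ← mul_pow]
    congr 1
    simp
    ring
  rw [coneForm, this, Complex.im_ofReal_mul, coneForm]

lemma realInner_real_smul_self (s : ℝ) (p : ℂ × ℂ) :
    realInner (s • p) (s • p) = s ^ 2 * realInner p p := by
  simp [realInner_self, mul_pow]
  ring

lemma image_bigW_eq_iff {k : ℕ} (hk : 1 ≤ k) (A : (ℂ × ℂ) ≃ₗ[ℝ] (ℂ × ℂ))
    (hA : ∀ v w : ℂ × ℂ, realInner (A v) (A w) = realInner v w) :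
    ⇑A '' bigW k = bigW k ↔ ∀ p, coneForm k (A p) = 0 ↔ coneForm k p = 0 := by
  have hpre : ⇑A '' bigW k = bigW k ↔ ∀ p, A p ∈ bigW k ↔ p ∈ bigW k := by
    constructor
    · intro h p
      conv_lhs => rw [← h]
      exact A.injective.mem_set_image
    · intro h
      ext q
      obtain ⟨p, rfl⟩ := A.surjective q
      rw [A.injective.mem_set_image, h]
  rw [hpre]
  simp only [mem_bigW_iff hk, hA]
  refine ⟨fun h p => ?_, fun h p => by rw [h]⟩
  by_cases hp : realInner p p = 0
  · have : p = 0 := by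
      rw [realInner_self] at hp
      have h1 : ‖p.1‖ = 0 := by nlinarith [sq_nonneg ‖p.1‖, sq_nonneg ‖p.2‖]
      have h2 : ‖p.2‖ = 0 := by nlinarith [sq_nonneg ‖p.1‖, sq_nonneg ‖p.2‖]
      exact Prod.ext (norm_eq_zero.1 h1) (norm_eq_zero.1 h2)
    simp [this]
  · have hpos : 0 < realInner p p :=
      lt_of_le_of_ne (by rw [realInner_self]; positivity) (Ne.symm hp)
    set s := (Real.sqrt (realInner p p))⁻¹ with hs
    have hs0 : s ≠ 0 := inv_ne_zero (Real.sqrt_pos.2 hpos).ne'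
    have h1 : s ^ 2 * realInner p p = 1 := by
      rw [hs, inv_pow, Real.sq_sqrt hpos.le, inv_mul_cancel₀ hp]
    have := h (s • p)
    simpa [realInner_real_smul_self, h1, coneForm_real_smul, hs0, map_smul] using this

lemma PreservesCone.mul {k : ℕ} {A B : (ℂ × ℂ) ≃ₗ[ℝ] (ℂ × ℂ)} (hA : PreservesCone k A)
    (hB : PreservesCone k B) : PreservesCone k (A * B) :=
  ⟨fun v w => by rw [LinearEquiv.mul_apply, LinearEquiv.mul_apply, hA.1, hB.1],
    fun p => by rw [LinearEquiv.mul_apply, hA.2, hB.2]⟩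

lemma PreservesCone.inv {k : ℕ} {A : (ℂ × ℂ) ≃ₗ[ℝ] (ℂ × ℂ)} (hA : PreservesCone k A) :
    PreservesCone k A⁻¹ := by
  have h : ∀ v, A (A⁻¹ v) = v := fun v => A.apply_symm_apply v
  exact ⟨fun v w => by rw [← hA.1, h, h], fun p => by rw [← hA.2, h]⟩

lemma exp_pi_div_pow {k : ℕ} (hk : 1 ≤ k) :
    Complex.exp (((π / k : ℝ) : ℂ) * Complex.I) ^ k = -1 := by
  have hk0 : (k : ℂ) ≠ 0 := by exact_mod_cast (by omega : k ≠ 0)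
  rw [← Complex.exp_nat_mul, ← Complex.exp_pi_mul_I]
  congr 1
  push_cast
  field_simp

lemma preservesCone_of_mem_genSetW {k : ℕ} (hk : 1 ≤ k) {A : (ℂ × ℂ) ≃ₗ[ℝ] (ℂ × ℂ)}
    (hA : A ∈ genSetW k) : PreservesCone k A := by
  have hu (x : ℝ) : Complex.exp (x * Complex.I) * (starRingEnd ℂ) (Complex.exp (x * Complex.I))
      = 1 := by
    rw [Complex.mul_conj, Complex.normSq_eq_norm_sq, Complex.norm_exp_ofReal_mul_I]; simp
  rcases hA with h | h | h | ⟨α, h⟩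
  · refine ⟨fun v w => ?_, fun p => ?_⟩
    · simp only [h, realInner, map_mul]
      congr 1
      linear_combination v.2 * (starRingEnd ℂ) w.2 * hu (π / k)
    · have : ((starRingEnd ℂ) p.1 * (Complex.exp (((π / k : ℝ) : ℂ) * Complex.I) * p.2)) ^ k
          = -((starRingEnd ℂ) p.1 * p.2) ^ k := by
        rw [mul_left_comm, mul_pow, exp_pi_div_pow hk, neg_one_mul]
      rw [coneForm, h, this, Complex.neg_im, neg_eq_zero, coneForm]
  · refine ⟨fun v w => ?_, fun p => ?_⟩
    · simp only [h, realInner]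
      simp
    · have : (starRingEnd ℂ) ((starRingEnd ℂ) p.1) * (starRingEnd ℂ) p.2
          = (starRingEnd ℂ) ((starRingEnd ℂ) p.1 * p.2) := by rw [map_mul]
      simp only [coneForm, h]
      rw [this, ← map_pow, Complex.conj_im, neg_eq_zero]
  · refine ⟨fun v w => ?_, fun p => ?_⟩
    · simp only [h, realInner]
      rw [add_comm]
    · have : (starRingEnd ℂ) p.2 * p.1 = (starRingEnd ℂ) ((starRingEnd ℂ) p.1 * p.2) := by
        rw [map_mul, Complex.conj_conj, mul_comm]
      simp only [coneForm, h]
      rw [this, ← map_pow, Complex.conj_im, neg_eq_zero]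
  · refine ⟨fun v w => ?_, fun p => ?_⟩
    · simp only [h, realInner, map_mul]
      congr 1
      linear_combination (v.1 * (starRingEnd ℂ) w.1 + v.2 * (starRingEnd ℂ) w.2) * hu α
    · simp only [coneForm, h, map_mul]
      rw [show ((starRingEnd ℂ) (Complex.exp (α * Complex.I)) * (starRingEnd ℂ) p.1 *
        (Complex.exp (α * Complex.I) * p.2)) = (starRingEnd ℂ) p.1 * p.2 by
          linear_combination (starRingEnd ℂ) p.1 * p.2 * hu α]

lemma PreservesCone.of_mem_closure {k : ℕ} (hk : 1 ≤ k) {A : (ℂ × ℂ) ≃ₗ[ℝ] (ℂ × ℂ)}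
    (hA : A ∈ Subgroup.closure (genSetW k)) : PreservesCone k A := by
  induction hA using Subgroup.closure_induction with
  | mem A hA => exact preservesCone_of_mem_genSetW hk hA
  | one => exact ⟨fun _ _ => rfl, fun _ => Iff.rfl⟩
  | mul A B _ _ hA hB => exact hA.mul hB
  | inv A _ hA => exact hA.inv

/-- The differential of `(z̄₁ z₂) ^ k` at `q`, up to the factor `k`, is
`v ↦ (q̄₁ q₂) ^ (k - 1) (v̄₁ q₂ + q̄₁ v₂)`. -/
lemma im_differential_eq_zero_of_coneForm_line {k : ℕ} (hk : 1 ≤ k) (q v : ℂ × ℂ)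
    (h : ∀ t : ℝ, coneForm k (q + t • v) = 0) :
    (((starRingEnd ℂ) q.1 * q.2) ^ (k - 1) *
      ((starRingEnd ℂ) v.1 * q.2 + (starRingEnd ℂ) q.1 * v.2)).im = 0 := by
  have hlin (a b : ℂ) : HasDerivAt (fun t : ℝ => a + (t : ℂ) * b) b 0 := by
    simpa using ((Complex.ofRealCLM.hasDerivAt (x := (0 : ℝ))).mul_const b).const_add a
  have hd := ((hlin ((starRingEnd ℂ) q.1) ((starRingEnd ℂ) v.1)).mul (hlin q.2 v.2)).pow k
  have him := Complex.imCLM.hasFDerivAt.comp_hasDerivAt (0 : ℝ) hd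
  have hzero : (Complex.imCLM ∘
      (((fun t : ℝ => (starRingEnd ℂ) q.1 + (t : ℂ) * (starRingEnd ℂ) v.1) *
        (fun t : ℝ => q.2 + (t : ℂ) * v.2)) ^ k)) = fun _ => (0 : ℝ) := by
    funext t
    have := h t
    simp only [coneForm, Prod.fst_add, Prod.snd_add, Prod.smul_fst, Prod.smul_snd, map_add,
      Complex.real_smul, map_mul, Complex.conj_ofReal] at this
    exact this
  rw [hzero] at him
  have := him.unique (hasDerivAt_const (0 : ℝ) (0 : ℝ))
  simp only [Complex.ofReal_zero, zero_mul, add_zero, Pi.mul_apply, Complex.imCLM_apply,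
    mul_assoc] at this
  have hk0 : (k : ℝ) ≠ 0 := by positivity
  rw [← Complex.ofReal_natCast, Complex.im_ofReal_mul] at this
  exact (mul_eq_zero.1 this).resolve_left hk0

/-- An isometry preserving the cone maps points of `C₁` to points of `C₁ ∪ C₂`. -/
lemma PreservesCone.fst_eq_zero_or_snd_eq_zero {k : ℕ} (hk : 2 ≤ k)
    {A : (ℂ × ℂ) ≃ₗ[ℝ] (ℂ × ℂ)} (hA : PreservesCone k A) {a : ℂ} (ha : a ≠ 0) :
    (A (a, 0)).1 = 0 ∨ (A (a, 0)).2 = 0 := by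
  by_contra! hne
  obtain ⟨h1, h2⟩ := hne
  set q := A (a, 0) with hq
  set c := ((starRingEnd ℂ) q.1 * q.2) ^ (k - 1) with hc
  have hc0 : c ≠ 0 := pow_ne_zero _ (mul_ne_zero (by simpa using h1) h2)
  let φ : ℂ × ℂ → ℝ := fun v => (c * ((starRingEnd ℂ) v.1 * q.2 + (starRingEnd ℂ) q.1 * v.2)).im
  have hadd (v w : ℂ × ℂ) : φ (v + w) = φ v + φ w := by
    simp only [φ, ← Complex.add_im, Prod.fst_add, Prod.snd_add, map_add]
    congr 1
    ring
  have hsmul (s : ℝ) (v : ℂ × ℂ) : φ (s • v) = s * φ v := by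
    simp only [φ, ← Complex.im_ofReal_mul, Prod.smul_fst, Prod.smul_snd, Complex.real_smul,
      map_mul, Complex.conj_ofReal]
    congr 1
    ring
  have hker (v : ℂ × ℂ) (hv : ∀ t : ℝ, coneForm k ((a, 0) + t • v) = 0) : φ (A v) = 0 := by
    refine im_differential_eq_zero_of_coneForm_line (by omega) q (A v) fun t => ?_
    rw [hq, ← map_smul, ← map_add, hA.2, hv]
  set ζ := Complex.exp (((π / k : ℝ) : ℂ) * Complex.I) with hζ
  have hζim : ζ.im ≠ 0 := by
    rw [hζ, Complex.exp_ofReal_mul_I_im]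
    have hk' : (2 : ℝ) ≤ k := by exact_mod_cast hk
    refine (Real.sin_pos_of_pos_of_lt_pi (by positivity) ?_).ne'
    rw [div_lt_iff₀ (by positivity)]
    nlinarith [Real.pi_pos]
  have hk0 : k ≠ 0 := by omega
  have hfst (b : ℂ) : φ (A (b, 0)) = 0 := hker _ fun t => by simp [coneForm, hk0]
  have hsnd : φ (A (0, a)) = 0 := hker _ fun t => by
    have : (starRingEnd ℂ) a * (t * a) = ((t * Complex.normSq a : ℝ) : ℂ) := by
      push_cast
      rw [Complex.normSq_eq_conj_mul_self]
      ring
    simp only [coneForm, Prod.fst_add, Prod.snd_add, Prod.smul_fst, Prod.smul_snd, smul_zero,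
      add_zero, zero_add, Complex.real_smul, this]
    rw [← Complex.ofReal_pow, Complex.ofReal_im]
  have hsnd' : φ (A (0, a * ζ)) = 0 := hker _ fun t => by
    have : (starRingEnd ℂ) a * (t * (a * ζ)) = ((t * Complex.normSq a : ℝ) : ℂ) * ζ := by
      push_cast
      rw [Complex.normSq_eq_conj_mul_self]
      ring
    simp only [coneForm, Prod.fst_add, Prod.snd_add, Prod.smul_fst, Prod.smul_snd, smul_zero,
      add_zero, zero_add, Complex.real_smul, this]
    rw [mul_pow, hζ, exp_pi_div_pow (by omega), ← Complex.ofReal_pow]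
    simp only [mul_neg, mul_one, Complex.neg_im, Complex.ofReal_im, neg_zero]
  have hall (v : ℂ × ℂ) : φ (A v) = 0 := by
    set s := (v.2 / a).im / ζ.im
    set r := (v.2 / a).re - s * ζ.re
    have hv : v.2 / a = r + s * ζ := by
      apply Complex.ext
      · simp [r]
      · simp [s, hζim]
    have : v = (v.1, 0) + (r • (0, a) + s • (0, a * ζ)) := by
      refine Prod.ext (by simp) ?_
      simp only [Prod.snd_add, Prod.smul_snd, Complex.real_smul, zero_add]
      rw [div_eq_iff ha] at hv
      rw [hv]
      ring
    rw [this, map_add, map_add, map_smul, map_smul, hadd, hadd, hsmul, hsmul, hfst, hsnd, hsnd']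
    simp
  obtain ⟨v, hv⟩ := A.surjective (0, Complex.I * ((starRingEnd ℂ) c * q.1))
  have h := hall v
  simp only [hv, φ] at h
  rw [show c * ((starRingEnd ℂ) (0 : ℂ) * q.2 +
      (starRingEnd ℂ) q.1 * (Complex.I * ((starRingEnd ℂ) c * q.1)))
      = ((Complex.normSq c * Complex.normSq q.1 : ℝ) : ℂ) * Complex.I by
    push_cast
    rw [Complex.normSq_eq_conj_mul_self, Complex.normSq_eq_conj_mul_self, map_zero]
    ring] at h
  simp [hc0, h1] at h

lemma PreservesCone.maps_axis {k : ℕ} (hk : 2 ≤ k)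
    {A : (ℂ × ℂ) ≃ₗ[ℝ] (ℂ × ℂ)} (hA : PreservesCone k A) :
    ((A (1, 0)).2 = 0 ∧ (A (Complex.I, 0)).2 = 0) ∨
      ((A (1, 0)).1 = 0 ∧ (A (Complex.I, 0)).1 = 0) := by
  have hne (a : ℂ) (ha : a ≠ 0) : ¬ ((A (a, 0)).1 = 0 ∧ (A (a, 0)).2 = 0) := fun h => by
    have : A (a, 0) = 0 := Prod.ext h.1 h.2
    simp [ha] at this
  have h1 := hA.fst_eq_zero_or_snd_eq_zero hk (one_ne_zero)
  have h2 := hA.fst_eq_zero_or_snd_eq_zero hk Complex.I_ne_zero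
  have hs : (1 + Complex.I : ℂ) ≠ 0 := fun h => by simpa using congrArg Complex.re h
  have h3 := hA.fst_eq_zero_or_snd_eq_zero hk hs
  have h4 : A (1 + Complex.I, 0) = A (1, 0) + A (Complex.I, 0) := by rw [← map_add]; simp
  rw [h4, Prod.fst_add, Prod.snd_add] at h3
  have n1 := hne 1 one_ne_zero
  have n2 := hne _ Complex.I_ne_zero
  grind

/-- A unit vector of the plane orthogonal to a unit vector `u` is `I * u` or its negative. -/
lemma eq_I_mul_or_eq_neg_I_mul {u v : ℂ} (hu : ‖u‖ = 1) (hv : ‖v‖ = 1)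
    (h : (v * (starRingEnd ℂ) u).re = 0) : v = Complex.I * u ∨ v = -(Complex.I * u) := by
  have huu : u * (starRingEnd ℂ) u = 1 := by
    rw [Complex.mul_conj, Complex.normSq_eq_norm_sq, hu]; simp
  set w := v * (starRingEnd ℂ) u with hw
  have hwn : ‖w‖ ^ 2 = 1 := by rw [hw, norm_mul, Complex.norm_conj, hu, hv]; simp
  have hvw : v = w * u := by rw [hw]; linear_combination -v * huu
  rw [← Complex.normSq_eq_norm_sq, Complex.normSq_apply, h] at hwn
  have : w.im = 1 ∨ w.im = -1 := by
    exact mul_self_eq_one_iff.1 (by linarith)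
  rcases this with h' | h'
  · left; rw [hvw]; congr 1; apply Complex.ext <;> simp [h, h']
  · right; rw [hvw, ← neg_mul]; congr 1; apply Complex.ext <;> simp [h, h']

/-- The reflection through the real points. -/
noncomputable def conjEquiv : (ℂ × ℂ) ≃ₗ[ℝ] (ℂ × ℂ) :=
  Complex.conjAe.toLinearEquiv.prodCongr Complex.conjAe.toLinearEquiv

/-- Rotation of the two factors by the angles `α` and `β`. -/
noncomputable def rotEquiv (α β : ℝ) : (ℂ × ℂ) ≃ₗ[ℝ] (ℂ × ℂ) :=
  (rotation (Circle.exp α)).toLinearEquiv.prodCongr (rotation (Circle.exp β)).toLinearEquiv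

lemma conjEquiv_apply (z : ℂ × ℂ) :
    conjEquiv z = ((starRingEnd ℂ) z.1, (starRingEnd ℂ) z.2) := rfl

lemma rotEquiv_apply (α β : ℝ) (z : ℂ × ℂ) :
    rotEquiv α β z = (Complex.exp (α * Complex.I) * z.1, Complex.exp (β * Complex.I) * z.2) := by
  simp [rotEquiv, rotation_apply, Circle.coe_exp]

lemma swap_mem_genSetW (k : ℕ) : LinearEquiv.prodComm ℝ ℂ ℂ ∈ genSetW k :=
  Or.inr (Or.inr (Or.inl fun _ => rfl))

lemma conjEquiv_mem_genSetW (k : ℕ) : conjEquiv ∈ genSetW k :=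
  Or.inr (Or.inl conjEquiv_apply)

lemma rotEquiv_self_mem_genSetW (k : ℕ) (α : ℝ) : rotEquiv α α ∈ genSetW k :=
  Or.inr (Or.inr (Or.inr ⟨α, rotEquiv_apply α α⟩))

lemma rotEquiv_zero_pi_div_mem_genSetW (k : ℕ) : rotEquiv 0 (π / k) ∈ genSetW k :=
  Or.inl fun z => by simp [rotEquiv_apply]

lemma PreservesCone.norm_sq {k : ℕ} {A : (ℂ × ℂ) ≃ₗ[ℝ] (ℂ × ℂ)} (hA : PreservesCone k A)
    (p : ℂ × ℂ) : ‖(A p).1‖ ^ 2 + ‖(A p).2‖ ^ 2 = ‖p.1‖ ^ 2 + ‖p.2‖ ^ 2 := by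
  rw [← realInner_self, hA.1, realInner_self]

lemma eq_smul_add_smul (p : ℂ × ℂ) : p = p.1.re • ((1 : ℂ), (0 : ℂ)) +
    p.1.im • (Complex.I, (0 : ℂ)) + (p.2.re • ((0 : ℂ), (1 : ℂ)) +
    p.2.im • ((0 : ℂ), Complex.I)) := by
  refine Prod.ext ?_ ?_
  · simp
  · simp

lemma PreservesCone.mem_closure_of_fixes_axis {k : ℕ} (hk : 2 ≤ k)
    {A : (ℂ × ℂ) ≃ₗ[ℝ] (ℂ × ℂ)} (hA : PreservesCone k A)
    (h1 : A (1, 0) = (1, 0)) (hI : A (Complex.I, 0) = (Complex.I, 0)) :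
    A ∈ Subgroup.closure (genSetW k) := by
  have hfst (b : ℂ) : (A (0, b)).1 = 0 := by
    have e1 := hA.1 (0, b) (1, 0)
    have e2 := hA.1 (0, b) (Complex.I, 0)
    rw [h1] at e1
    rw [hI] at e2
    apply Complex.ext
    · simpa [realInner] using e1
    · simpa [realInner] using e2
  set w := (A (0, 1)).2 with hw
  have hA1 : A (0, 1) = (0, w) := Prod.ext (hfst 1) rfl
  have hAI : A (0, Complex.I) = (0, (A (0, Complex.I)).2) := Prod.ext (hfst _) rfl
  have hwn : ‖w‖ = 1 := by
    have := hA.norm_sq (0, 1)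
    exact norm_eq_one_of_sq (by simpa [hA1] using this)
  have hvn : ‖(A (0, Complex.I)).2‖ = 1 := by
    have := hA.norm_sq (0, Complex.I)
    rw [hAI] at this
    exact norm_eq_one_of_sq (by simpa using this)
  have horth : ((A (0, Complex.I)).2 * (starRingEnd ℂ) w).re = 0 := by
    have := hA.1 (0, Complex.I) (0, 1)
    rw [hAI, hA1] at this
    simpa [realInner] using this
  have hw0 : w ≠ 0 := fun h => by simp [h] at hwn
  have hwk : (w ^ k).im = 0 := by
    have := (hA.2 (1, 1)).2 (by simp [coneForm])
    rw [show ((1, 1) : ℂ × ℂ) = (1, 0) + (0, 1) by simp, map_add, h1, hA1] at this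
    simpa [coneForm] using this
  have hdecomp (p : ℂ × ℂ) : A p = (p.1, p.2.re * w + p.2.im * (A (0, Complex.I)).2) := by
    conv_lhs => rw [eq_smul_add_smul p]
    rw [map_add, map_add, map_add, map_smul, map_smul, map_smul, map_smul, h1, hI, hA1, hAI]
    refine Prod.ext ?_ ?_
    · simp
    · simp
  rcases eq_I_mul_or_eq_neg_I_mul hwn hvn horth with hv | hv
  · have hw2 : w ^ (2 * k) = 1 := by
      have hr : w ^ k = ((w ^ k).re : ℂ) := Complex.ext rfl (by simpa using hwk)
      have hn : ‖w ^ k‖ = 1 := by rw [norm_pow, hwn, one_pow]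
      rw [hr, Complex.norm_real, Real.norm_eq_abs] at hn
      rw [mul_comm, pow_mul, hr, ← Complex.ofReal_pow, ← sq_abs, hn]
      simp
    have : NeZero (2 * k) := ⟨by omega⟩
    obtain ⟨i, -, hi⟩ := (Complex.isPrimitiveRoot_exp (2 * k) (by omega)).eq_pow_of_pow_eq_one hw2
    have hζ : Complex.exp (2 * π * Complex.I / ((2 * k : ℕ) : ℂ))
        = Complex.exp (((π / k : ℝ) : ℂ) * Complex.I) := by
      congr 1
      have hk0 : (k : ℂ) ≠ 0 := by exact_mod_cast (by omega : k ≠ 0)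
      push_cast
      field_simp
    rw [hζ] at hi
    have hpow (n : ℕ) (p : ℂ × ℂ) : (rotEquiv 0 (π / k) ^ n) p
        = (p.1, Complex.exp (((π / k : ℝ) : ℂ) * Complex.I) ^ n * p.2) := by
      induction n with
      | zero => simp
      | succ n ih =>
        rw [pow_succ', LinearEquiv.mul_apply, ih, rotEquiv_apply, pow_succ']
        simp [mul_assoc]
    have : A = rotEquiv 0 (π / k) ^ i := by
      ext p : 1
      rw [hpow, hdecomp, hi, hv]
      refine Prod.ext rfl ?_
      conv_rhs => rw [← Complex.re_add_im p.2]
      ring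
    rw [this]
    exact pow_mem (Subgroup.subset_closure (rotEquiv_zero_pi_div_mem_genSetW k)) i
  · exfalso
    set e := Complex.exp (((π / (4 * k) : ℝ) : ℂ) * Complex.I) with he
    have hconj (p : ℂ × ℂ) : A p = (p.1, w * (starRingEnd ℂ) p.2) := by
      rw [hdecomp, hv]
      refine Prod.ext rfl ?_
      have : (starRingEnd ℂ) p.2 = p.2.re - p.2.im * Complex.I := by
        apply Complex.ext <;> simp
      simp only [this]
      ring
    have hee : (starRingEnd ℂ) e * e = 1 := by
      rw [← Complex.normSq_eq_conj_mul_self, Complex.normSq_eq_norm_sq, he,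
        Complex.norm_exp_ofReal_mul_I]
      simp
    have hek : (e * e) ^ k = Complex.I := by
      have hk0 : (k : ℂ) ≠ 0 := by exact_mod_cast (by omega : k ≠ 0)
      rw [he, ← Complex.exp_add, ← Complex.exp_nat_mul]
      refine Eq.trans (congrArg Complex.exp ?_) Complex.exp_pi_div_two_mul_I
      push_cast
      field_simp
      norm_num
    have := (hA.2 (e, e)).2 (by simp only [coneForm, hee]; simp)
    rw [hconj] at this
    simp only [coneForm] at this
    rw [show (starRingEnd ℂ) e * (w * (starRingEnd ℂ) e) = w * (starRingEnd ℂ) (e * e) by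
      rw [map_mul]; ring, mul_pow, ← map_pow, hek] at this
    have hre : (w ^ k).re = 0 := by simpa using this
    exact pow_ne_zero k hw0 (Complex.ext hre hwk)

lemma PreservesCone.mem_closure_of_fst {k : ℕ} (hk : 2 ≤ k)
    {A : (ℂ × ℂ) ≃ₗ[ℝ] (ℂ × ℂ)} (hA : PreservesCone k A)
    (h1 : (A (1, 0)).2 = 0) (hI : A (Complex.I, 0) = (Complex.I * (A (1, 0)).1, 0)) :
    A ∈ Subgroup.closure (genSetW k) := by
  set u := (A (1, 0)).1 with hu
  have hA1 : A (1, 0) = (u, 0) := Prod.ext rfl h1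
  have hun : ‖u‖ = 1 := by
    have := hA.norm_sq (1, 0)
    exact norm_eq_one_of_sq (by simpa [hA1] using this)
  have hG := rotEquiv_self_mem_genSetW k (-u.arg)
  have hexp : Complex.exp (((-u.arg : ℝ) : ℂ) * Complex.I) * u = 1 := by
    have := Complex.norm_mul_exp_arg_mul_I u
    rw [hun, Complex.ofReal_one, one_mul] at this
    calc Complex.exp (((-u.arg : ℝ) : ℂ) * Complex.I) * u
        = Complex.exp (((-u.arg : ℝ) : ℂ) * Complex.I) * Complex.exp (u.arg * Complex.I) := by
          rw [this]
      _ = 1 := by rw [← Complex.exp_add]; simp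
  refine (Subgroup.mul_mem_cancel_left _ (Subgroup.subset_closure hG)).1
    (PreservesCone.mem_closure_of_fixes_axis hk
      ((preservesCone_of_mem_genSetW (by omega) hG).mul hA) ?_ ?_)
  · rw [LinearEquiv.mul_apply, hA1, rotEquiv_apply, hexp, mul_zero]
  · rw [LinearEquiv.mul_apply, hI, rotEquiv_apply, mul_left_comm, hexp, mul_zero, mul_one]

lemma PreservesCone.mem_closure_of_maps_axis {k : ℕ} (hk : 2 ≤ k)
    {A : (ℂ × ℂ) ≃ₗ[ℝ] (ℂ × ℂ)} (hA : PreservesCone k A)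
    (h1 : (A (1, 0)).2 = 0) (hI : (A (Complex.I, 0)).2 = 0) :
    A ∈ Subgroup.closure (genSetW k) := by
  have hun : ‖(A (1, 0)).1‖ = 1 :=
    norm_eq_one_of_sq (by simpa [h1] using hA.norm_sq (1, 0))
  have hvn : ‖(A (Complex.I, 0)).1‖ = 1 :=
    norm_eq_one_of_sq (by simpa [hI] using hA.norm_sq (Complex.I, 0))
  have horth : ((A (Complex.I, 0)).1 * (starRingEnd ℂ) (A (1, 0)).1).re = 0 := by
    simpa [realInner, h1, hI] using hA.1 (Complex.I, 0) (1, 0)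
  rcases eq_I_mul_or_eq_neg_I_mul hun hvn horth with hv | hv
  · exact hA.mem_closure_of_fst hk h1 (Prod.ext hv hI)
  · have hG := conjEquiv_mem_genSetW k
    refine (Subgroup.mul_mem_cancel_left _ (Subgroup.subset_closure hG)).1
      (PreservesCone.mem_closure_of_fst hk
        ((preservesCone_of_mem_genSetW (by omega) hG).mul hA) ?_ ?_)
    · simp [LinearEquiv.mul_apply, conjEquiv_apply, h1]
    · simp [LinearEquiv.mul_apply, conjEquiv_apply, hI, hv]

lemma PreservesCone.mem_closure {k : ℕ} (hk : 2 ≤ k)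
    {A : (ℂ × ℂ) ≃ₗ[ℝ] (ℂ × ℂ)} (hA : PreservesCone k A) :
    A ∈ Subgroup.closure (genSetW k) := by
  rcases hA.maps_axis hk with ⟨h1, hI⟩ | ⟨h1, hI⟩
  · exact hA.mem_closure_of_maps_axis hk h1 hI
  · have hG := swap_mem_genSetW k
    exact (Subgroup.mul_mem_cancel_left _ (Subgroup.subset_closure hG)).1
      (PreservesCone.mem_closure_of_maps_axis hk
        ((preservesCone_of_mem_genSetW (by omega) hG).mul hA) h1 hI)

/-- The stabilizer of `𝒲_k` in `O(4)` is the subgroup generated by the four listed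
families of isometries. -/
theorem stabilizer_of_Wk (k : ℕ) (hk : 2 ≤ k) :
    {A : (ℂ × ℂ) ≃ₗ[ℝ] (ℂ × ℂ) |
      (∀ v w : ℂ × ℂ, realInner (A v) (A w) = realInner v w) ∧ ⇑A '' bigW k = bigW k} =
    ↑(Subgroup.closure (genSetW k)) := by
  ext A
  rw [Set.mem_ofPred_eq, SetLike.mem_coe]
  constructor
  · rintro ⟨hA, hW⟩
    exact PreservesCone.mem_closure hk ⟨hA, (image_bigW_eq_iff (by omega) A hA).1 hW⟩
  · intro h
    obtain ⟨hA, hc⟩ := PreservesCone.of_mem_closure (by omega) h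
    exact ⟨hA, (image_bigW_eq_iff (by omega) A hA).2 hc⟩
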